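/- Let N ≥ 2, let ω = B₁(0) ⊂ ℝ^N be the open unit ball, and let K ≥ 0. Then there exist R̄ > 0, ε > 0 and C > 0, depending only on N and K, with the following property: for every continuous a : ω → ℝ with 0 ≤ a ≤ K, every C² function u : ω → ℝ with u ≥ 0 on ω and −Δu(x) + a(x)u(x) ≥ 0 for all x ∈ ω, every x₀ ∈ ∂ω and every R ∈ (0, R̄], one has inf_{x ∈ B_R(x₀) ∩ ω} u(x)/(1−|x|) ≥ C · ( ∫_{B_R(x₀) ∩ ω} ( u(x)/(1−|x|) )^ε dx )^{1/ε}. -/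

import Mathlib

open MeasureTheory Metric Set

/-- The Laplacian of a real-valued function on `ℝ^N`, as the sum of second
partial derivatives in the coordinate directions. -/
noncomputable def lap {N : ℕ} (u : EuclideanSpace ℝ (Fin N) → ℝ)
    (x : EuclideanSpace ℝ (Fin N)) : ℝ :=
  ∑ i : Fin N, fderiv ℝ (fun y => fderiv ℝ u y (EuclideanSpace.single i 1)) x
    (EuclideanSpace.single i 1)

open Filter Topology

section Supersolution

variable {N : ℕ}

local notation "E" => EuclideanSpace ℝ (Fin N)

/-- The truncated power `((r² - |x|²)⁺)^k`, supported in the closed ball of radius `r`. -/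
noncomputable def bump (r : ℝ) (k : ℕ) (x : EuclideanSpace ℝ (Fin N)) : ℝ :=
  (max (r ^ 2 - ‖x‖ ^ 2) 0) ^ k

lemma bump_nonneg (r : ℝ) (k : ℕ) (x : E) : 0 ≤ bump r k x :=
  pow_nonneg (le_max_right _ _) _

lemma continuous_bump (r : ℝ) (k : ℕ) : Continuous (bump r k : E → ℝ) := by
  unfold bump; fun_prop

lemma bump_eq_zero {r : ℝ} (hr : 0 ≤ r) (k : ℕ) {x : E} (hx : r ≤ ‖x‖) :
    bump r (k + 1) x = 0 := by
  have : r ^ 2 - ‖x‖ ^ 2 ≤ 0 := by nlinarith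
  simp [bump, max_eq_right this]

lemma tsupport_bump_subset {r : ℝ} (hr : 0 ≤ r) (k : ℕ) :
    tsupport (bump r (k + 1) : E → ℝ) ⊆ closedBall 0 r := by
  refine closure_minimal (fun x hx => ?_) isClosed_closedBall
  by_contra h
  refine hx (bump_eq_zero hr k ?_)
  simp only [mem_closedBall, dist_zero_right, not_le] at h
  exact h.le

lemma hasCompactSupport_bump {r : ℝ} (hr : 0 ≤ r) (k : ℕ) :
    HasCompactSupport (bump r (k + 1) : E → ℝ) :=
  HasCompactSupport.of_support_subset_isCompact (isCompact_closedBall 0 r)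
    ((subset_tsupport _).trans (tsupport_bump_subset hr k))

lemma hasDerivAt_max_zero_pow (k : ℕ) (t : ℝ) :
    HasDerivAt (fun t : ℝ => (max t 0) ^ (k + 2)) ((k + 2) * (max t 0) ^ (k + 1)) t := by
  rcases lt_trichotomy t 0 with h | h | h
  · rw [max_eq_right h.le]
    have : (fun t : ℝ => (max t 0) ^ (k + 2)) =ᶠ[𝓝 t] fun _ => 0 := by
      filter_upwards [Iio_mem_nhds h] with s hs
      simp [max_eq_right (mem_Iio.1 hs).le]
    simpa using (hasDerivAt_const t (0 : ℝ)).congr_of_eventuallyEq this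
  · subst h
    have h1 : HasDerivAt (fun t : ℝ => t ^ 2) 0 0 := by
      simpa using hasDerivAt_pow 2 (0 : ℝ)
    simp only [max_self, ne_eq, Nat.add_eq_zero_iff, one_ne_zero, and_false, not_false_eq_true,
      zero_pow, mul_zero]
    rw [hasDerivAt_iff_isLittleO] at h1 ⊢
    refine Asymptotics.IsBigO.trans_isLittleO ?_ h1
    refine Asymptotics.IsBigO.of_bound 1 ?_
    filter_upwards [Ioo_mem_nhds (neg_one_lt_zero (R := ℝ)) one_pos] with s hs
    have h2 : max s 0 ≤ |s| := max_le (le_abs_self s) (abs_nonneg s)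
    have h0 : 0 ≤ max s 0 := le_max_right _ _
    have h3 : max s 0 ≤ 1 := max_le hs.2.le zero_le_one
    simp only [max_self, ne_eq, Nat.add_eq_zero_iff, OfNat.ofNat_ne_zero, and_false,
      not_false_eq_true, zero_pow, sub_zero, smul_zero, one_mul]
    rw [Real.norm_of_nonneg (by positivity), Real.norm_of_nonneg (by positivity)]
    calc (max s 0) ^ (k + 2) = (max s 0) ^ k * (max s 0) ^ 2 := pow_add _ _ _
      _ ≤ 1 * |s| ^ 2 := by gcongr; exact pow_le_one₀ h0 h3
      _ = s ^ 2 := by simp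
  · rw [max_eq_left h.le]
    have : (fun t : ℝ => (max t 0) ^ (k + 2)) =ᶠ[𝓝 t] fun t => t ^ (k + 2) := by
      filter_upwards [Ioi_mem_nhds h] with s hs
      simp [max_eq_left (mem_Ioi.1 hs).le]
    simpa using (hasDerivAt_pow (k + 2) t).congr_of_eventuallyEq this

lemma hasFDerivAt_bump (r : ℝ) (k : ℕ) (x : E) :
    HasFDerivAt (bump r (k + 2) : E → ℝ)
      ((((k : ℝ) + 2) * bump r (k + 1) x) • (-(2 • innerSL ℝ x) : E →L[ℝ] ℝ)) x := by
  have h1 : HasFDerivAt (fun y : E => r ^ 2 - ‖y‖ ^ 2) (-(2 • innerSL ℝ x)) x :=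
    (hasStrictFDerivAt_norm_sq x).hasFDerivAt.const_sub _
  exact (hasDerivAt_max_zero_pow k (r ^ 2 - ‖x‖ ^ 2)).comp_hasFDerivAt x h1

lemma fderiv_bump_single (r : ℝ) (k : ℕ) (x : E) (i : Fin N) :
    fderiv ℝ (bump r (k + 2)) x (EuclideanSpace.single i 1)
      = -(2 * ((k : ℝ) + 2)) * (x i * bump r (k + 1) x) := by
  rw [(hasFDerivAt_bump r k x).fderiv]
  simp [EuclideanSpace.inner_single_right]
  ring

lemma sum_fderiv_coord_mul_bump (r : ℝ) (k : ℕ) (x : E) :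
    ∑ i, fderiv ℝ (fun y : E => y i * bump r (k + 2) y) x (EuclideanSpace.single i 1)
      = N * bump r (k + 2) x - 2 * ((k : ℝ) + 2) * (‖x‖ ^ 2 * bump r (k + 1) x) := by
  have h : ∀ i, fderiv ℝ (fun y : E => y i * bump r (k + 2) y) x (EuclideanSpace.single i 1)
      = bump r (k + 2) x - 2 * ((k : ℝ) + 2) * (x i ^ 2 * bump r (k + 1) x) := by
    intro i
    have h1 : HasFDerivAt (fun y : E => y i) (EuclideanSpace.proj i : E →L[ℝ] ℝ) x :=
      (EuclideanSpace.proj i : E →L[ℝ] ℝ).hasFDerivAt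
    have h2 : fderiv ℝ (fun y : E => y i * bump r (k + 2) y) x = _ :=
      (h1.mul (hasFDerivAt_bump r k x)).fderiv
    rw [h2]
    simp [EuclideanSpace.inner_single_right]
    ring
  simp_rw [h]
  rw [Finset.sum_sub_distrib, ← Finset.mul_sum, ← Finset.sum_mul, EuclideanSpace.real_norm_sq_eq]
  simp

lemma continuous_mul_of_tsupport_subset {X : Type*} [TopologicalSpace X] {Ω : Set X}
    (hΩ : IsOpen Ω) {f g : X → ℝ} (hf : ContinuousOn f Ω) (hg : Continuous g)
    (hs : tsupport g ⊆ Ω) : Continuous fun x => f x * g x := by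
  refine continuous_of_tsupport fun x hx => ?_
  have hx' : x ∈ Ω := hs (closure_mono (Function.support_mul_subset_right f g) hx)
  exact (hf.continuousAt (hΩ.mem_nhds hx')).mul hg.continuousAt

lemma integrable_mul_of_tsupport_subset {Ω : Set E} (hΩ : IsOpen Ω) {f g : E → ℝ}
    (hf : ContinuousOn f Ω) (hg : Continuous g) (hc : HasCompactSupport g)
    (hs : tsupport g ⊆ Ω) : Integrable fun x => f x * g x :=
  (continuous_mul_of_tsupport_subset hΩ hf hg hs).integrable_of_hasCompactSupport hc.mul_left

lemma integral_fderiv_mul_eq_neg {Ω : Set E} (hΩ : IsOpen Ω) {f g : E → ℝ} {v : E}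
    (hf : ContDiffOn ℝ 1 f Ω) (hg : Differentiable ℝ g)
    (hg' : Continuous fun x => fderiv ℝ g x v) (hc : HasCompactSupport g)
    (hs : tsupport g ⊆ Ω) :
    ∫ x, fderiv ℝ f x v * g x = -∫ x, f x * fderiv ℝ g x v := by
  have hs' : tsupport (fun x => fderiv ℝ g x v) ⊆ tsupport g :=
    tsupport_fderiv_apply_subset ℝ v
  have hf' : ContinuousOn (fun x => fderiv ℝ f x v) Ω :=
    (hf.continuousOn_fderiv_of_isOpen hΩ le_rfl).clm_apply continuousOn_const
  rw [integral_mul_fderiv_eq_neg_fderiv_mul_of_integrable, neg_neg]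
  · exact integrable_mul_of_tsupport_subset hΩ hf' hg.continuous hc hs
  · exact integrable_mul_of_tsupport_subset hΩ hf.continuousOn hg'
      (hc.mono' (subset_closure.trans hs')) (hs'.trans hs)
  · exact integrable_mul_of_tsupport_subset hΩ hf.continuousOn hg.continuous hc hs
  · exact fun x hx => (hf.differentiableOn one_ne_zero).differentiableAt (hΩ.mem_nhds (hs hx))
  · exact fun x _ => hg x

lemma ContDiffOn.fderiv_apply_of_isOpen {Ω : Set E} (hΩ : IsOpen Ω) {u : E → ℝ}
    (hu : ContDiffOn ℝ 2 u Ω) (v : E) : ContDiffOn ℝ 1 (fun y => fderiv ℝ u y v) Ω :=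
  (hu.fderiv_of_isOpen hΩ (by norm_num)).clm_apply contDiffOn_const

lemma continuousOn_fderiv_fderiv_apply {Ω : Set E} (hΩ : IsOpen Ω) {u : E → ℝ}
    (hu : ContDiffOn ℝ 2 u Ω) (v w : E) :
    ContinuousOn (fun x => fderiv ℝ (fun y => fderiv ℝ u y v) x w) Ω :=
  ((hu.fderiv_apply_of_isOpen hΩ v).continuousOn_fderiv_of_isOpen hΩ le_rfl).clm_apply
    continuousOn_const

lemma continuousOn_lap {Ω : Set E} (hΩ : IsOpen Ω) {u : E → ℝ}
    (hu : ContDiffOn ℝ 2 u Ω) : ContinuousOn (lap u) Ω :=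
  continuousOn_finsetSum _ fun _ _ => continuousOn_fderiv_fderiv_apply hΩ hu _ _

lemma integrable_mul_bump {Ω : Set E} (hΩ : IsOpen Ω) {r : ℝ} (hr : 0 ≤ r)
    (hrΩ : closedBall 0 r ⊆ Ω) {f : E → ℝ} (hf : ContinuousOn f Ω) (k : ℕ) :
    Integrable fun x => f x * bump r (k + 1) x :=
  integrable_mul_of_tsupport_subset hΩ hf (continuous_bump r _) (hasCompactSupport_bump hr k)
    ((tsupport_bump_subset hr k).trans hrΩ)

lemma integral_mul_coord_mul_bump {Ω : Set E} (hΩ : IsOpen Ω) {r : ℝ} (hr : 0 ≤ r)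
    (hrΩ : closedBall 0 r ⊆ Ω) {f : E → ℝ} (hf : ContDiffOn ℝ 1 f Ω) (k : ℕ) (i : Fin N) :
    ∫ x, fderiv ℝ f x (EuclideanSpace.single i 1) * bump r (k + 2) x
      = 2 * ((k : ℝ) + 2) * ∫ x, f x * (x i * bump r (k + 1) x) := by
  have hd : ∀ x : E, fderiv ℝ (bump r (k + 2)) x (EuclideanSpace.single i 1)
      = -(2 * ((k : ℝ) + 2)) * (x i * bump r (k + 1) x) := fun x => fderiv_bump_single r k x i
  rw [integral_fderiv_mul_eq_neg hΩ hf
    (fun x => (hasFDerivAt_bump r k x).differentiableAt) ?_ (hasCompactSupport_bump hr _)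
    ((tsupport_bump_subset hr _).trans hrΩ)]
  · rw [← integral_const_mul, ← integral_neg]
    congr 1 with x
    rw [hd]; ring
  · simp_rw [hd]
    have := continuous_bump (N := N) r (k + 1)
    fun_prop

lemma integral_lap_mul_bump {Ω : Set E} (hΩ : IsOpen Ω) {r : ℝ} (hr : 0 ≤ r)
    (hrΩ : closedBall 0 r ⊆ Ω) {u : E → ℝ} (hu : ContDiffOn ℝ 2 u Ω) (k : ℕ) :
    ∫ x, lap u x * bump r (k + 3) x = 2 * ((k : ℝ) + 3) *
      ∫ x, u x * (2 * ((k : ℝ) + 2) * (‖x‖ ^ 2 * bump r (k + 1) x) - N * bump r (k + 2) x) := by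
  have hb := continuous_bump (N := N) r (k + 2)
  have hb1 := continuous_bump (N := N) r (k + 1)
  have hs : ∀ i : Fin N, HasCompactSupport (fun x : E => x i * bump r (k + 2) x) := fun i =>
    (hasCompactSupport_bump hr _).mul_left
  have hs' : ∀ i : Fin N, tsupport (fun x : E => x i * bump r (k + 2) x) ⊆ Ω := fun i =>
    (closure_mono (Function.support_mul_subset_right _ _)).trans
      ((tsupport_bump_subset hr _).trans hrΩ)
  have hC : ∀ i : Fin N, ContDiff ℝ 1 (fun x : E => x i * bump r (k + 2) x) := by
    intro i
    refine (EuclideanSpace.proj i : E →L[ℝ] ℝ).contDiff.mul ?_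
    rw [contDiff_one_iff_fderiv]
    refine ⟨fun x => (hasFDerivAt_bump r k x).differentiableAt, ?_⟩
    rw [funext fun x => (hasFDerivAt_bump (N := N) r k x).fderiv]
    have : Continuous fun x : E => innerSL ℝ x := (innerSL ℝ).continuous
    fun_prop
  have hD : ∀ i : Fin N, Continuous fun x =>
      fderiv ℝ (fun x : E => x i * bump r (k + 2) x) x (EuclideanSpace.single i 1) := fun i =>
    ((hC i).continuous_fderiv one_ne_zero).clm_apply continuous_const
  have hint : ∀ i : Fin N, Integrable fun x => u x *
      fderiv ℝ (fun x : E => x i * bump r (k + 2) x) x (EuclideanSpace.single i 1) := fun i =>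
    integrable_mul_of_tsupport_subset hΩ hu.continuousOn (hD i)
      ((hs i).fderiv_apply ℝ _)
      ((tsupport_fderiv_apply_subset ℝ _).trans (hs' i))
  calc ∫ x, lap u x * bump r (k + 3) x
      = ∑ i, ∫ x, fderiv ℝ (fun y => fderiv ℝ u y (EuclideanSpace.single i 1)) x
          (EuclideanSpace.single i 1) * bump r (k + 3) x := by
        rw [← integral_finsetSum]
        · simp_rw [lap, Finset.sum_mul]
        · exact fun i _ => integrable_mul_bump hΩ hr hrΩ
            (continuousOn_fderiv_fderiv_apply hΩ hu _ _) _
    _ = ∑ i, 2 * ((k : ℝ) + 3) * -∫ x, u x *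
          fderiv ℝ (fun x : E => x i * bump r (k + 2) x) x (EuclideanSpace.single i 1) := by
        refine Finset.sum_congr rfl fun i _ => ?_
        have h1 := integral_mul_coord_mul_bump hΩ hr hrΩ
          (hu.fderiv_apply_of_isOpen hΩ (EuclideanSpace.single i 1)) (k + 1) i
        rw [h1, integral_fderiv_mul_eq_neg hΩ (hu.of_le (by norm_num))
          ((hC i).differentiable one_ne_zero) (hD i) (hs i) (hs' i)]
        push_cast
        ring
    _ = _ := by
        rw [← Finset.mul_sum, Finset.sum_neg_distrib, ← integral_finsetSum _ fun i _ => hint i,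
          ← integral_neg]
        congr 2 with x
        rw [← Finset.mul_sum, sum_fderiv_coord_mul_bump]
        ring

lemma integral_mul_bump_le {K : ℝ} (hK : 0 ≤ K) {u : E → ℝ}
    (hu : ContDiffOn ℝ 2 u (ball 0 1)) (hu0 : ∀ x ∈ ball (0 : E) 1, 0 ≤ u x)
    (hsup : ∀ x ∈ ball (0 : E) 1, lap u x ≤ K * u x) {k : ℕ} (hk : 2 * N + K + 1 ≤ (k : ℝ) + 2)
    {r : ℝ} (hr0 : 0 ≤ r) (hr1 : r < 1) :
    ∫ x, u x * bump r (k + 1) x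
      ≤ (K + 2 * ((k : ℝ) + 3) * N + 1) * ∫ x in ball (0 : E) (1 / 2), u x := by
  have hrΩ : closedBall (0 : E) r ⊆ ball 0 1 := closedBall_subset_ball hr1
  have hI := fun j => integrable_mul_bump isOpen_ball hr0 hrΩ hu.continuousOn j
  have hI' : Integrable fun x => u x * (‖x‖ ^ 2 * bump r (k + 1) x) := by
    have := integrable_mul_bump isOpen_ball hr0 hrΩ
      (hu.continuousOn.mul (f := u) (g := fun x : E => ‖x‖ ^ 2) (by fun_prop)) k
    simpa [mul_assoc] using this
  have hball : IntegrableOn u (ball (0 : E) (1 / 2)) :=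
    ((hu.continuousOn.mono (closedBall_subset_ball (by norm_num))).integrableOn_compact
      (isCompact_closedBall (0 : E) (1 / 2))).mono_set ball_subset_closedBall
  have h1 := integral_lap_mul_bump isOpen_ball hr0 hrΩ hu k
  have h2 : ∫ x, lap u x * bump r (k + 3) x ≤ ∫ x, K * (u x * bump r (k + 3) x) := by
    refine integral_mono (integrable_mul_bump isOpen_ball hr0 hrΩ
      (continuousOn_lap isOpen_ball hu) _) ((hI _).const_mul _) fun x => ?_
    by_cases hx : x ∈ ball (0 : E) 1
    · simp only [← mul_assoc]
      exact mul_le_mul_of_nonneg_right (hsup x hx) (bump_nonneg _ _ _)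
    · have : r ≤ ‖x‖ := hr1.le.trans (by simpa using hx)
      simp [bump_eq_zero hr0 (k + 2) this]
  rw [h1] at h2
  have hi : Integrable ((ball (0 : E) (1 / 2)).indicator u) :=
    hball.integrable_indicator measurableSet_ball
  have hJ : Integrable fun x => 2 * ((k : ℝ) + 3) *
      (u x * (2 * ((k : ℝ) + 2) * (‖x‖ ^ 2 * bump r (k + 1) x) - N * bump r (k + 2) x)) := by
    refine Integrable.const_mul ?_ _
    have := (hI'.const_mul (2 * ((k : ℝ) + 2))).sub ((hI (k + 1)).const_mul (N : ℝ))
    refine this.congr (Eventually.of_forall fun x => ?_)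
    simp only [Pi.sub_apply]
    ring
  have hL : Integrable fun x => K * (u x * bump r (k + 3) x) := (hI _).const_mul _
  have hJK : Integrable fun x => 2 * ((k : ℝ) + 3) *
      (u x * (2 * ((k : ℝ) + 2) * (‖x‖ ^ 2 * bump r (k + 1) x) - N * bump r (k + 2) x))
        - K * (u x * bump r (k + 3) x) := hJ.sub hL
  have h3 : ∫ x, u x * bump r (k + 1) x
      ≤ ∫ x, ((K + 2 * ((k : ℝ) + 3) * N + 1) * (ball (0 : E) (1 / 2)).indicator u x
        + (2 * ((k : ℝ) + 3) * (u x * (2 * ((k : ℝ) + 2) * (‖x‖ ^ 2 * bump r (k + 1) x)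
          - N * bump r (k + 2) x)) - K * (u x * bump r (k + 3) x))) := by
    refine integral_mono (hI _) ((hi.const_mul _).add hJK) ?_
    intro x
    by_cases hx : x ∈ ball (0 : E) 1
    · have hux := hu0 x hx
      have ht1 : ‖x‖ < 1 := by simpa using hx
      set s := max (r ^ 2 - ‖x‖ ^ 2) 0 with hs
      have hs0 : 0 ≤ s := le_max_right _ _
      have hs1 : s ≤ 1 := max_le (by nlinarith [sq_nonneg ‖x‖]) zero_le_one
      have hb : ∀ j, bump r j x = s ^ j := fun j => rfl
      have hp0 : 0 ≤ s ^ (k + 1) := by positivity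
      have hp1 : s ^ (k + 1) ≤ 1 := pow_le_one₀ hs0 hs1
      have hks : K * s ^ 2 ≤ K := mul_le_of_le_one_right hK (pow_le_one₀ hs0 hs1)
      have hns : 2 * ((k : ℝ) + 3) * N * s ≤ 2 * ((k : ℝ) + 3) * N :=
        mul_le_of_le_one_right (by positivity) hs1
      simp only [hb]
      by_cases hx2 : x ∈ ball (0 : E) (1 / 2)
      · rw [indicator_of_mem hx2]
        have h4 : s ^ (k + 1) * (K * s ^ 2 + 2 * ((k : ℝ) + 3) * N * s + 1
            - 4 * (k + 3) * (k + 2) * ‖x‖ ^ 2) ≤ K + 2 * ((k : ℝ) + 3) * N + 1 := by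
          calc _ ≤ s ^ (k + 1) * (K + 2 * ((k : ℝ) + 3) * N + 1) := by
                gcongr
                have : 0 ≤ 4 * ((k : ℝ) + 3) * (k + 2) * ‖x‖ ^ 2 := by positivity
                linarith
            _ ≤ _ := mul_le_of_le_one_left (by positivity) hp1
        have h5 := mul_le_mul_of_nonneg_left h4 hux
        have e2 : s ^ (k + 2) = s ^ (k + 1) * s := by ring
        have e3 : s ^ (k + 3) = s ^ (k + 1) * s ^ 2 := by ring
        rw [e2, e3]
        linarith
      · rw [indicator_of_notMem hx2]
        have hx3 : 1 / 2 ≤ ‖x‖ := by simpa using hx2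
        have hx4 : 1 / 4 ≤ ‖x‖ ^ 2 := by nlinarith
        have h4 : s ^ (k + 1) * (K * s ^ 2 + 2 * ((k : ℝ) + 3) * N * s + 1
            - 4 * (k + 3) * (k + 2) * ‖x‖ ^ 2) ≤ 0 := by
          refine mul_nonpos_of_nonneg_of_nonpos hp0 ?_
          have h6 : ((k : ℝ) + 3) * (k + 2) ≤ 4 * (k + 3) * (k + 2) * ‖x‖ ^ 2 := by
            have : 0 ≤ ((k : ℝ) + 3) * (k + 2) := by positivity
            nlinarith
          have h7 : ((k : ℝ) + 3) * (2 * N + K + 1) ≤ (k + 3) * (k + 2) := by gcongr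
          have h8 : 0 ≤ (k : ℝ) := by positivity
          nlinarith [mul_nonneg h8 hK]
        have h5 := mul_le_mul_of_nonneg_left h4 hux
        have e2 : s ^ (k + 2) = s ^ (k + 1) * s := by ring
        have e3 : s ^ (k + 3) = s ^ (k + 1) * s ^ 2 := by ring
        rw [e2, e3]
        linarith
    · have h6 : r ≤ ‖x‖ := hr1.le.trans (by simpa using hx)
      have h7 : x ∉ ball (0 : E) (1 / 2) := fun h => hx (ball_subset_ball (by norm_num) h)
      simp only [bump_eq_zero hr0 _ h6, indicator_of_notMem h7]
      simp
  rw [integral_add (hi.const_mul _) hJK, integral_const_mul,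
    integral_indicator measurableSet_ball, integral_sub hJ hL] at h3
  simp only [integral_const_mul] at h2 h3
  linarith

lemma fderiv_apply_eq_sum (L : E →L[ℝ] ℝ) (y : E) :
    L y = ∑ i, L (EuclideanSpace.single i 1) * y i := by
  conv_lhs => rw [← (EuclideanSpace.basisFun (Fin N) ℝ).sum_repr y]
  simp [mul_comm]

lemma hasDerivAt_integral_bump {u : E → ℝ} (hu : ContDiffOn ℝ 2 u (ball 0 1)) {x : E}
    (hx : ‖x‖ ≤ 1 / 8) {t : ℝ} (ht : t ∈ Ioo (-(13 / 16) : ℝ) (13 / 16)) :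
    HasDerivAt (fun t : ℝ => ∫ y, u (x + t • y) * bump 1 1 y)
      (t / 4 * ∫ y, lap u (x + t • y) * bump 1 2 y) t := by
  have hmem : ∀ t ∈ Ioo (-(13 / 16) : ℝ) (13 / 16), ∀ y ∈ closedBall (0 : E) 1,
      x + t • y ∈ closedBall (0 : E) (15 / 16) := by
    intro t ht y hy
    rw [mem_closedBall_zero_iff] at hy ⊢
    have h1 : |t| ≤ 13 / 16 := abs_le.2 ⟨ht.1.le, ht.2.le⟩
    calc ‖x + t • y‖ ≤ ‖x‖ + |t| * ‖y‖ := by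
          simpa [norm_smul] using norm_add_le x (t • y)
      _ ≤ 1 / 8 + 13 / 16 * 1 := by gcongr
      _ = 15 / 16 := by norm_num
  have hsub : closedBall (0 : E) (15 / 16) ⊆ ball 0 1 := closedBall_subset_ball (by norm_num)
  set Ω : ℝ → Set E := fun t => (fun y => x + t • y) ⁻¹' ball 0 1 with hΩ
  have hΩo : ∀ t, IsOpen (Ω t) := fun t => isOpen_ball.preimage (by fun_prop)
  have hΩs : ∀ t ∈ Ioo (-(13 / 16) : ℝ) (13 / 16), closedBall (0 : E) 1 ⊆ Ω t :=
    fun t ht y hy => hsub (hmem t ht y hy)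
  have hdu : ContinuousOn (fderiv ℝ u) (ball 0 1) :=
    hu.continuousOn_fderiv_of_isOpen isOpen_ball (by norm_num)
  obtain ⟨L, hL⟩ := (isCompact_closedBall (0 : E) (15 / 16)).exists_bound_of_continuousOn
    (hdu.mono hsub)
  have hcomp : ∀ t, ∀ {F : Type} [TopologicalSpace F] {g : E → F}, ContinuousOn g (ball 0 1) →
      ContinuousOn (fun y => g (x + t • y)) (Ω t) := fun t F _ g hg =>
    hg.comp (f := fun y => x + t • y) (by fun_prop) fun y hy => hy
  have hI : ∀ t ∈ Ioo (-(13 / 16) : ℝ) (13 / 16),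
      Integrable fun y => u (x + t • y) * bump 1 1 y := fun t ht =>
    integrable_mul_bump (hΩo t) zero_le_one (hΩs t ht) (hcomp t hu.continuousOn) 0
  have hI' : ∀ t ∈ Ioo (-(13 / 16) : ℝ) (13 / 16),
      Integrable fun y => fderiv ℝ u (x + t • y) y * bump 1 1 y := fun t ht =>
    integrable_mul_bump (hΩo t) zero_le_one (hΩs t ht)
      ((hcomp t hdu).clm_apply continuousOn_id) 0
  have hnhds := Ioo_mem_nhds ht.1 ht.2
  have key := hasDerivAt_integral_of_dominated_loc_of_deriv_le
    (F := fun (t : ℝ) y => u (x + t • y) * bump 1 1 y)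
    (F' := fun (t : ℝ) y => fderiv ℝ u (x + t • y) y * bump 1 1 y)
    (bound := fun y => L * bump 1 1 y) hnhds
    (by filter_upwards [hnhds] with t ht using (hI t ht).aestronglyMeasurable)
    (hI t ht) (hI' t ht).aestronglyMeasurable
    (Eventually.of_forall fun y t ht => ?_)
    (integrable_mul_bump isOpen_univ zero_le_one (subset_univ _) continuousOn_const 0)
    (Eventually.of_forall fun y t ht => ?_)
  · refine key.2.congr_deriv (Eq.symm ?_)
    have hf : ∀ i : Fin N, ContDiffOn ℝ 1
        (fun y => fderiv ℝ u (x + t • y) (EuclideanSpace.single i 1)) (Ω t) := fun i =>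
      (hu.fderiv_apply_of_isOpen isOpen_ball (EuclideanSpace.single i 1)).comp
        (f := fun y => x + t • y) (by fun_prop) fun y hy => hy
    have hlapI : ∀ i : Fin N, Integrable fun y =>
        fderiv ℝ (fun y => fderiv ℝ u (x + t • y) (EuclideanSpace.single i 1)) y
          (EuclideanSpace.single i 1) * bump 1 2 y := fun i =>
      integrable_mul_bump (hΩo t) zero_le_one (hΩs t ht)
        (((hf i).continuousOn_fderiv_of_isOpen (hΩo t) le_rfl).clm_apply continuousOn_const) 1
    have hcI : ∀ i : Fin N, Integrable fun y =>
        fderiv ℝ u (x + t • y) (EuclideanSpace.single i 1) * (y i * bump 1 1 y) := by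
      intro i
      have := integrable_mul_bump (hΩo t) zero_le_one (hΩs t ht)
        ((hf i).continuousOn.mul (g := fun y : E => y i) (by fun_prop)) 0
      simpa [mul_assoc] using this
    have e1 : ∫ y, fderiv ℝ u (x + t • y) y * bump 1 1 y
        = ∑ i, ∫ y, fderiv ℝ u (x + t • y) (EuclideanSpace.single i 1) * (y i * bump 1 1 y) := by
      rw [← integral_finsetSum _ fun i _ => hcI i]
      congr 1 with y
      rw [fderiv_apply_eq_sum (fderiv ℝ u (x + t • y)) y, Finset.sum_mul]
      simp only [mul_assoc]
    have e2 : t * ∫ y, lap u (x + t • y) * bump 1 2 y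
        = ∑ i, ∫ y, fderiv ℝ (fun y => fderiv ℝ u (x + t • y) (EuclideanSpace.single i 1)) y
          (EuclideanSpace.single i 1) * bump 1 2 y := by
      rw [← integral_finsetSum _ fun i _ => hlapI i, ← integral_const_mul]
      congr 1 with y
      by_cases hy : y ∈ closedBall (0 : E) 1
      · rw [← Finset.sum_mul, ← mul_assoc, lap, Finset.mul_sum]
        congr 1
        refine Finset.sum_congr rfl fun i _ => ?_
        have h1 : HasFDerivAt (fun y : E => x + t • y) (t • ContinuousLinearMap.id ℝ E) y :=
          ((hasFDerivAt_id y).const_smul t).const_add x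
        have h2 : DifferentiableAt ℝ (fun z => fderiv ℝ u z (EuclideanSpace.single i 1))
            (x + t • y) :=
          ((hu.fderiv_apply_of_isOpen isOpen_ball _).differentiableOn one_ne_zero).differentiableAt
            (isOpen_ball.mem_nhds (hΩs t ht hy))
        have h3 : fderiv ℝ (fun y => fderiv ℝ u (x + t • y) (EuclideanSpace.single i 1)) y = _ :=
          (HasFDerivAt.comp
            (g := fun z => fderiv ℝ u z (EuclideanSpace.single i 1)) y h2.hasFDerivAt h1).fderiv
        rw [h3]
        simp
      · have : (1 : ℝ) ≤ ‖y‖ := by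
          rw [mem_closedBall_zero_iff] at hy; exact (not_le.1 hy).le
        simp [bump_eq_zero zero_le_one 1 this]
    rw [e1, div_mul_eq_mul_div, e2, Finset.sum_div]
    refine Finset.sum_congr rfl fun i _ => ?_
    rw [integral_mul_coord_mul_bump (hΩo t) zero_le_one (hΩs t ht) (hf i) 0 i]
    norm_num
  · by_cases hy : y ∈ closedBall (0 : E) 1
    · rw [norm_mul, Real.norm_of_nonneg (bump_nonneg _ _ _)]
      refine mul_le_mul_of_nonneg_right ?_ (bump_nonneg _ _ _)
      have h1 := hL _ (hmem t ht y hy)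
      refine ((fderiv ℝ u (x + t • y)).le_opNorm y).trans ?_
      rw [mem_closedBall_zero_iff] at hy
      exact (mul_le_of_le_one_right (norm_nonneg _) hy).trans h1
    · have : (1 : ℝ) ≤ ‖y‖ := by
        rw [mem_closedBall_zero_iff] at hy; exact (not_le.1 hy).le
      simp [bump_eq_zero zero_le_one 0 this]
  · by_cases hy : y ∈ closedBall (0 : E) 1
    · have h1 : HasDerivAt (fun t : ℝ => x + t • y) y t := by
        simpa using ((hasDerivAt_id t).smul_const y).const_add x
      have h2 : DifferentiableAt ℝ u (x + t • y) :=
        (hu.differentiableOn two_ne_zero).differentiableAt (isOpen_ball.mem_nhds (hΩs t ht hy))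
      exact (h2.hasFDerivAt.comp_hasDerivAt t h1).mul_const _
    · have : (1 : ℝ) ≤ ‖y‖ := by
        rw [mem_closedBall_zero_iff] at hy; exact (not_le.1 hy).le
      simpa [bump_eq_zero zero_le_one 0 this] using hasDerivAt_const t (0 : ℝ)

lemma setIntegral_half_ball_le {K : ℝ} (hK : 0 ≤ K) {u : E → ℝ}
    (hu : ContDiffOn ℝ 2 u (ball 0 1)) (hu0 : ∀ x ∈ ball (0 : E) 1, 0 ≤ u x)
    (hsup : ∀ x ∈ ball (0 : E) 1, lap u x ≤ K * u x) {x : E} (hx : ‖x‖ ≤ 1 / 8) :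
    ∫ z in ball (0 : E) (1 / 2), u z
      ≤ 36 / 11 * Real.exp K * (∫ y, bump 1 1 (y : E)) * u x := by
  have hmem : ∀ t ∈ Icc (0 : ℝ) (3 / 4), ∀ y : E, ‖y‖ ≤ 1 → x + t • y ∈ ball (0 : E) 1 := by
    intro t ht y hy
    rw [mem_ball_zero_iff]
    calc ‖x + t • y‖ ≤ ‖x‖ + t * ‖y‖ := by
          simpa [norm_smul, abs_of_nonneg ht.1] using norm_add_le x (t • y)
      _ ≤ 1 / 8 + 3 / 4 * 1 := by gcongr; exact ht.2
      _ < 1 := by norm_num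
  have hnn : ∀ t ∈ Icc (0 : ℝ) (3 / 4), ∀ k, ∀ y : E, 0 ≤ u (x + t • y) * bump 1 (k + 1) y := by
    intro t ht k y
    rcases le_total ‖y‖ 1 with hy | hy
    · exact mul_nonneg (hu0 _ (hmem t ht y hy)) (bump_nonneg _ _ _)
    · simp [bump_eq_zero zero_le_one k hy]
  have hI : ∀ t ∈ Icc (0 : ℝ) (3 / 4), ∀ k, ∀ {f : E → ℝ}, ContinuousOn f (ball 0 1) →
      Integrable fun y => f (x + t • y) * bump 1 (k + 1) y := by
    intro t ht k f hf
    refine integrable_mul_bump (Ω := (fun y => x + t • y) ⁻¹' ball 0 1)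
      (isOpen_ball.preimage (by fun_prop)) zero_le_one (fun y hy => hmem t ht y (by simpa using hy))
      (hf.comp (f := fun y => x + t • y) (by fun_prop) fun y hy => hy) k
  set M : ℝ → ℝ := fun t => ∫ y, u (x + t • y) * bump 1 1 y with hM
  have hM' : ∀ t ∈ Icc (0 : ℝ) (3 / 4),
      HasDerivAt M (t / 4 * ∫ y, lap u (x + t • y) * bump 1 2 y) t := fun t ht =>
    hasDerivAt_integral_bump hu hx ⟨by linarith [ht.1], by linarith [ht.2]⟩
  have hlap : ∀ t ∈ Icc (0 : ℝ) (3 / 4),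
      t / 4 * ∫ y, lap u (x + t • y) * bump 1 2 y ≤ K * M t := by
    intro t ht
    have h1 : ∫ y, lap u (x + t • y) * bump 1 2 y ≤ ∫ y, K * (u (x + t • y) * bump 1 1 y) := by
      refine integral_mono (hI t ht 1 (continuousOn_lap isOpen_ball hu))
        ((hI t ht 0 hu.continuousOn).const_mul _) fun y => ?_
      rcases le_total ‖y‖ 1 with hy | hy
      · have h2 := hmem t ht y hy
        have h3 : bump 1 2 y ≤ bump 1 1 y :=
          pow_le_pow_of_le_one (le_max_right _ _)
            (max_le (by nlinarith [sq_nonneg ‖y‖]) zero_le_one) one_le_two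
        calc lap u (x + t • y) * bump 1 2 y
            ≤ K * u (x + t • y) * bump 1 2 y :=
              mul_le_mul_of_nonneg_right (hsup _ h2) (bump_nonneg _ _ _)
          _ ≤ K * u (x + t • y) * bump 1 1 y :=
              mul_le_mul_of_nonneg_left h3 (mul_nonneg hK (hu0 _ h2))
          _ = _ := mul_assoc _ _ _
      · simp [bump_eq_zero zero_le_one 0 hy, bump_eq_zero zero_le_one 1 hy]
    rw [integral_const_mul] at h1
    have h2 : 0 ≤ K * M t := mul_nonneg hK (integral_nonneg (hnn t ht 0))
    calc t / 4 * ∫ y, lap u (x + t • y) * bump 1 2 y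
        ≤ t / 4 * (K * M t) := mul_le_mul_of_nonneg_left h1 (by linarith [ht.1])
      _ ≤ K * M t := mul_le_of_le_one_left h2 (by linarith [ht.2])
  have hanti : AntitoneOn (fun t => Real.exp (-K * t) * M t) (Icc 0 (3 / 4)) := by
    have hd : ∀ t ∈ Icc (0 : ℝ) (3 / 4), HasDerivAt (fun t => Real.exp (-K * t) * M t)
        (Real.exp (-K * t) * (-K * 1) * M t
          + Real.exp (-K * t) * (t / 4 * ∫ y, lap u (x + t • y) * bump 1 2 y)) t := fun t ht =>
      (((hasDerivAt_id t).const_mul (-K)).exp).mul (hM' t ht)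
    refine antitoneOn_of_deriv_nonpos (convex_Icc _ _)
      (fun t ht => (hd t ht).continuousAt.continuousWithinAt)
      (fun t ht => (hd t (interior_subset ht)).differentiableAt.differentiableWithinAt)
      fun t ht => ?_
    rw [(hd t (interior_subset ht)).deriv]
    have := mul_le_mul_of_nonneg_left (hlap t (interior_subset ht)) (Real.exp_pos (-K * t)).le
    linarith
  have h34 : (3 / 4 : ℝ) ∈ Icc (0 : ℝ) (3 / 4) := ⟨by norm_num, le_rfl⟩
  have h1 : M (3 / 4) ≤ Real.exp K * M 0 := by
    have h2 := hanti ⟨le_rfl, by norm_num⟩ h34 (by norm_num : (0 : ℝ) ≤ 3 / 4)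
    simp only [mul_zero, Real.exp_zero, one_mul] at h2
    have h3 : 0 ≤ M (3 / 4) := integral_nonneg (hnn _ h34 0)
    have h4 : Real.exp (-K) * M (3 / 4) ≤ M 0 := by
      refine le_trans ?_ h2
      gcongr
      linarith
    calc M (3 / 4) = Real.exp K * (Real.exp (-K) * M (3 / 4)) := by
          rw [← mul_assoc, ← Real.exp_add]; simp
      _ ≤ _ := by gcongr
  have h2 : M 0 = (∫ y, bump 1 1 (y : E)) * u x := by
    simp only [hM, zero_smul, add_zero]
    rw [integral_const_mul, mul_comm]
  have hG : ∀ z : E, u (x + (3 / 4 : ℝ) • ((3 / 4 : ℝ)⁻¹ • (z - x)))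
      = u z := fun z => by rw [smul_inv_smul₀ (by norm_num)]; simp
  have h3 : ∫ z, u z * bump 1 1 ((3 / 4 : ℝ)⁻¹ • (z - x)) ≤ M (3 / 4) := by
    have h4 := Measure.integral_comp_smul (volume : Measure E)
      (fun y => u (x + (3 / 4 : ℝ) • y) * bump 1 1 y) ((3 / 4 : ℝ)⁻¹)
    have h5 := integral_sub_right_eq_self
      (fun z => u (x + (3 / 4 : ℝ) • ((3 / 4 : ℝ)⁻¹ • z)) * bump 1 1 ((3 / 4 : ℝ)⁻¹ • z))
      (μ := (volume : Measure E)) x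
    simp only [hG] at h5
    rw [h5, h4, smul_eq_mul]
    refine mul_le_of_le_one_left (integral_nonneg (hnn _ h34 0)) ?_
    rw [inv_pow, inv_inv, abs_of_nonneg (by positivity)]
    exact pow_le_one₀ (by norm_num) (by norm_num)
  have hGI : Integrable fun z => u z * bump 1 1 ((3 / 4 : ℝ)⁻¹ • (z - x)) := by
    have h4 := ((hI _ h34 0 hu.continuousOn).comp_smul
      (R := (3 / 4 : ℝ)⁻¹) (by norm_num)).comp_sub_right x
    simpa only [hG] using h4
  have hball : IntegrableOn u (ball (0 : E) (1 / 2)) :=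
    ((hu.continuousOn.mono (closedBall_subset_ball (by norm_num))).integrableOn_compact
      (isCompact_closedBall (0 : E) (1 / 2))).mono_set ball_subset_closedBall
  have h4 : 11 / 36 * ∫ z in ball (0 : E) (1 / 2), u z
      ≤ ∫ z, u z * bump 1 1 ((3 / 4 : ℝ)⁻¹ • (z - x)) := by
    rw [← integral_const_mul]
    refine le_trans (setIntegral_mono_on (hball.const_mul _) hGI.integrableOn measurableSet_ball
      fun z hz => ?_) (setIntegral_le_integral hGI (Eventually.of_forall fun z => ?_))
    · rw [mul_comm]
      refine mul_le_mul_of_nonneg_left ?_ (hu0 z (ball_subset_ball (by norm_num) hz))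
      rw [mem_ball_zero_iff] at hz
      have h5 : ‖z - x‖ ≤ 5 / 8 := (norm_sub_le z x).trans (by linarith)
      have h6 : ‖(3 / 4 : ℝ)⁻¹ • (z - x)‖ ≤ 5 / 6 := by
        rw [norm_smul]; norm_num; linarith
      rw [bump, pow_one]
      refine le_trans ?_ (le_max_left _ _)
      nlinarith [norm_nonneg ((3 / 4 : ℝ)⁻¹ • (z - x))]
    · have := hnn _ h34 0 ((3 / 4 : ℝ)⁻¹ • (z - x))
      rwa [hG] at this
  rw [h2] at h1
  nlinarith

lemma IsLocalMin.deriv_deriv_nonneg {f : ℝ → ℝ} {a : ℝ} (h : IsLocalMin f a)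
    (hc : ContinuousAt f a) : 0 ≤ deriv (deriv f) a := by
  by_contra! hneg
  have hmax := isLocalMax_of_deriv_deriv_neg hneg h.deriv_eq_zero hc
  have hconst : f =ᶠ[𝓝 a] fun _ => f a := by
    filter_upwards [h, hmax] with x h1 h2 using le_antisymm h2 h1
  have h1 : deriv f =ᶠ[𝓝 a] fun _ => 0 := by
    filter_upwards [hconst.eventuallyEq_nhds] with x hx
    rw [hx.deriv_eq, deriv_const]
  rw [h1.deriv_eq, deriv_const] at hneg
  exact lt_irrefl _ hneg

lemma IsLocalMin.lap_nonneg {Ω : Set E} (hΩ : IsOpen Ω) {v : E → ℝ} (hv : ContDiffOn ℝ 2 v Ω)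
    {x : E} (hx : x ∈ Ω) (h : IsLocalMin v x) : 0 ≤ lap v x := by
  refine Finset.sum_nonneg fun i _ => ?_
  set e : E := EuclideanSpace.single i 1
  have hline : ∀ t : ℝ, HasDerivAt (fun t : ℝ => x + t • e) e t := fun t => by
    simpa using ((hasDerivAt_id t).smul_const e).const_add x
  have hcont : Tendsto (fun t : ℝ => x + t • e) (𝓝 0) (𝓝 x) := by
    simpa using (hline 0).continuousAt.tendsto
  have hev : ∀ᶠ t in 𝓝 (0 : ℝ), x + t • e ∈ Ω := hcont (hΩ.mem_nhds hx)
  have h1 : deriv (fun t : ℝ => v (x + t • e)) =ᶠ[𝓝 0] fun t => fderiv ℝ v (x + t • e) e := by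
    filter_upwards [hev] with t ht
    have hd : DifferentiableAt ℝ v (x + t • e) :=
      (hv.differentiableOn two_ne_zero).differentiableAt (hΩ.mem_nhds ht)
    exact (hd.hasFDerivAt.comp_hasDerivAt t (hline t)).deriv
  have h2 : deriv (deriv fun t : ℝ => v (x + t • e)) 0
      = fderiv ℝ (fun y => fderiv ℝ v y e) x e := by
    rw [h1.deriv_eq]
    have hd : DifferentiableAt ℝ (fun y => fderiv ℝ v y e) (x + (0 : ℝ) • e) := by
      rw [zero_smul, add_zero]
      exact ((hv.fderiv_apply_of_isOpen hΩ e).differentiableOn one_ne_zero).differentiableAt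
        (hΩ.mem_nhds hx)
    have h3 := (hd.hasFDerivAt.comp_hasDerivAt (0 : ℝ) (hline 0)).deriv
    simpa [Function.comp_def] using h3
  rw [← h2]
  refine IsLocalMin.deriv_deriv_nonneg ?_ ?_
  · have := hcont.eventually h
    simpa [IsLocalMin, IsMinFilter] using this
  · have hd : DifferentiableAt ℝ v x :=
      (hv.differentiableOn two_ne_zero).differentiableAt (hΩ.mem_nhds hx)
    have hc := hd.continuousAt.tendsto.comp hcont
    simpa [ContinuousAt, Function.comp_def] using hc

lemma lap_sub {Ω : Set E} (hΩ : IsOpen Ω) {u w : E → ℝ} (hu : ContDiffOn ℝ 2 u Ω)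
    (hw : ContDiffOn ℝ 2 w Ω) {x : E} (hx : x ∈ Ω) :
    lap (fun y => u y - w y) x = lap u x - lap w x := by
  rw [lap, lap, lap, ← Finset.sum_sub_distrib]
  refine Finset.sum_congr rfl fun i _ => ?_
  have hd : ∀ {f : E → ℝ}, ContDiffOn ℝ 2 f Ω → ∀ y ∈ Ω, DifferentiableAt ℝ f y :=
    fun hf y hy => (hf.differentiableOn two_ne_zero).differentiableAt (hΩ.mem_nhds hy)
  have hd' : ∀ {f : E → ℝ}, ContDiffOn ℝ 2 f Ω →
      DifferentiableAt ℝ (fun y => fderiv ℝ f y (EuclideanSpace.single i 1)) x := fun hf =>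
    ((hf.fderiv_apply_of_isOpen hΩ _).differentiableOn one_ne_zero).differentiableAt
      (hΩ.mem_nhds hx)
  have h1 : (fun y => fderiv ℝ (fun z => u z - w z) y (EuclideanSpace.single i 1)) =ᶠ[𝓝 x]
      fun y => fderiv ℝ u y (EuclideanSpace.single i 1)
        - fderiv ℝ w y (EuclideanSpace.single i 1) := by
    filter_upwards [hΩ.mem_nhds hx] with y hy
    rw [fderiv_fun_sub (hd hu y hy) (hd hw y hy)]
    rfl
  rw [h1.fderiv_eq, fderiv_fun_sub (hd' hu) (hd' hw)]
  rfl

lemma lap_exp_barrier (m l r : ℝ) (x : E) :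
    lap (fun y : E => m * (Real.exp (l * (r ^ 2 - ‖y‖ ^ 2)) - 1)) x
      = m * Real.exp (l * (r ^ 2 - ‖x‖ ^ 2)) * (4 * l ^ 2 * ‖x‖ ^ 2 - 2 * l * N) := by
  have hexp : ∀ y : E, HasFDerivAt (fun y : E => Real.exp (l * (r ^ 2 - ‖y‖ ^ 2)))
      (Real.exp (l * (r ^ 2 - ‖y‖ ^ 2)) • (l • (-(2 • innerSL ℝ y) : E →L[ℝ] ℝ))) y := fun y =>
    (((hasStrictFDerivAt_norm_sq y).hasFDerivAt.const_sub (r ^ 2)).const_mul l).exp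
  have h1 : ∀ i : Fin N,
      (fun y : E => fderiv ℝ (fun y : E => m * (Real.exp (l * (r ^ 2 - ‖y‖ ^ 2)) - 1)) y
        (EuclideanSpace.single i 1))
      = fun y : E => (-2 * m * l) * (y i * Real.exp (l * (r ^ 2 - ‖y‖ ^ 2))) := by
    intro i
    ext y
    rw [(((hexp y).sub_const 1).const_mul m).fderiv]
    simp [EuclideanSpace.inner_single_right]
    ring
  have h2 : ∀ i : Fin N, fderiv ℝ
      (fun y : E => (-2 * m * l) * (y i * Real.exp (l * (r ^ 2 - ‖y‖ ^ 2)))) x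
        (EuclideanSpace.single i 1)
      = m * Real.exp (l * (r ^ 2 - ‖x‖ ^ 2)) * (4 * l ^ 2 * x i ^ 2 - 2 * l) := by
    intro i
    have h3 : HasFDerivAt (fun y : E => y i) (EuclideanSpace.proj i : E →L[ℝ] ℝ) x :=
      (EuclideanSpace.proj i : E →L[ℝ] ℝ).hasFDerivAt
    have h4 : fderiv ℝ (fun y : E => (-2 * m * l) * (y i * Real.exp (l * (r ^ 2 - ‖y‖ ^ 2)))) x
      = _ := ((h3.mul (hexp x)).const_mul (-2 * m * l)).fderiv
    rw [h4]
    simp [EuclideanSpace.inner_single_right]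
    ring
  simp_rw [lap, h1, h2]
  rw [← Finset.mul_sum, Finset.sum_sub_distrib, ← Finset.mul_sum, EuclideanSpace.real_norm_sq_eq,
    Finset.sum_const, Finset.card_univ, Fintype.card_fin, nsmul_eq_mul]
  ring

lemma exp_barrier_le {K : ℝ} (hK : 0 ≤ K) {u : E → ℝ}
    (hu : ContDiffOn ℝ 2 u (ball 0 1)) (hu0 : ∀ x ∈ ball (0 : E) 1, 0 ≤ u x)
    (hsup : ∀ x ∈ ball (0 : E) 1, lap u x ≤ K * u x) {l m r : ℝ}
    (hl : l = 16 * (2 * N + K + 1)) (hm : 0 < m) (hr0 : 0 ≤ r) (hr1 : r < 1)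
    (hmin : ∀ x : E, ‖x‖ ≤ 1 / 8 → m * (Real.exp l - 1) ≤ u x) {x : E}
    (hx : 1 / 8 ≤ ‖x‖) (hxr : ‖x‖ ≤ r) :
    m * (Real.exp (l * (r ^ 2 - ‖x‖ ^ 2)) - 1) ≤ u x := by
  have hl0 : 16 ≤ l := by
    have : (0 : ℝ) ≤ N := by positivity
    linarith
  set w : E → ℝ := fun y => m * (Real.exp (l * (r ^ 2 - ‖y‖ ^ 2)) - 1) with hw
  have hwC : ContDiff ℝ 2 w := by
    have : ContDiff ℝ 2 fun y : E => ‖y‖ ^ 2 := contDiff_norm_sq ℝ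
    fun_prop
  have hv : ContDiffOn ℝ 2 (fun y => u y - w y) (ball 0 1) := hu.sub hwC.contDiffOn
  set A : Set E := {y | 1 / 8 ≤ ‖y‖} ∩ closedBall 0 r
  have hAc : IsCompact A :=
    (isCompact_closedBall 0 r).inter_left (isClosed_le continuous_const continuous_norm)
  have hA1 : A ⊆ ball 0 1 := fun y hy => closedBall_subset_ball hr1 hy.2
  obtain ⟨z, hz, hzmin⟩ := hAc.exists_isMinOn ⟨x, hx, by simpa using hxr⟩
    (hv.continuousOn.mono hA1)
  have hzx : u z - w z ≤ u x - w x := hzmin ⟨hx, by simpa using hxr⟩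
  suffices 0 ≤ u z - w z by linarith
  by_contra! hneg
  have hz1 : 1 / 8 ≤ ‖z‖ := hz.1
  have hz2 : ‖z‖ ≤ r := by simpa using hz.2
  have hz3 : 1 / 8 < ‖z‖ := by
    refine lt_of_le_of_ne hz1 fun h => ?_
    have h1 := hmin z h.ge
    have h2 : w z ≤ m * (Real.exp l - 1) := by
      simp only [hw]
      gcongr
      exact mul_le_of_le_one_right (by linarith) (by nlinarith [sq_nonneg ‖z‖])
    linarith
  have hz4 : ‖z‖ < r := by
    refine lt_of_le_of_ne hz2 fun h => ?_
    have h1 := hu0 z (hA1 hz)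
    have h2 : w z = 0 := by simp [hw, h]
    linarith
  have hloc : IsLocalMin (fun y => u y - w y) z := by
    refine hzmin.isLocalMin ?_
    filter_upwards [(isOpen_lt continuous_const continuous_norm).mem_nhds hz3,
      isOpen_ball.mem_nhds (show z ∈ ball (0 : E) r by simpa using hz4)] with y h1 h2
    exact ⟨le_of_lt h1, ball_subset_closedBall h2⟩
  have h1 := hloc.lap_nonneg isOpen_ball hv (hA1 hz)
  rw [lap_sub isOpen_ball hu hwC.contDiffOn (hA1 hz), lap_exp_barrier] at h1
  have h2 := hsup z (hA1 hz)
  set p := m * Real.exp (l * (r ^ 2 - ‖z‖ ^ 2)) with hp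
  have hp0 : 0 < p := by positivity
  have h3 : u z ≤ p := by
    have : w z = p - m := by simp only [hw, hp]; ring
    linarith
  have h4 : K * u z ≤ K * p := by gcongr
  have h5 : K + 1 ≤ 4 * l ^ 2 * ‖z‖ ^ 2 - 2 * l * N := by
    have h6 : (1 / 8) ^ 2 ≤ ‖z‖ ^ 2 := by gcongr
    have h7 : l ^ 2 * (1 / 8) ^ 2 ≤ l ^ 2 * ‖z‖ ^ 2 := by gcongr
    have h8 : l * l = l * (16 * (2 * N + K + 1)) := congrArg (l * ·) hl
    nlinarith
  have h9 : p * (K + 1) ≤ p * (4 * l ^ 2 * ‖z‖ ^ 2 - 2 * l * N) := by gcongr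
  nlinarith

lemma le_of_le_on_closedBall {K : ℝ} (hK : 0 ≤ K) {u : E → ℝ}
    (hu : ContDiffOn ℝ 2 u (ball 0 1)) (hu0 : ∀ x ∈ ball (0 : E) 1, 0 ≤ u x)
    (hsup : ∀ x ∈ ball (0 : E) 1, lap u x ≤ K * u x) {l m : ℝ}
    (hl : l = 16 * (2 * N + K + 1)) (hm : 0 ≤ m)
    (hmin : ∀ x : E, ‖x‖ ≤ 1 / 8 → m * (Real.exp l - 1) ≤ u x) {x : E} (hx : ‖x‖ < 1) :
    m * l * (1 - ‖x‖) ≤ u x := by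
  have hl0 : 16 ≤ l := by
    have : (0 : ℝ) ≤ N := by positivity
    linarith
  rcases hm.eq_or_lt with rfl | hm
  · simpa using hu0 x (by simpa using hx)
  rcases le_total ‖x‖ (1 / 8) with h | h
  · refine le_trans ?_ (hmin x h)
    calc m * l * (1 - ‖x‖) ≤ m * l :=
          mul_le_of_le_one_right (by positivity) (by linarith [norm_nonneg x])
      _ ≤ _ := by gcongr; linarith [Real.add_one_le_exp l]
  · have hlim : m * (Real.exp (l * (1 ^ 2 - ‖x‖ ^ 2)) - 1) ≤ u x := by
      have hc : Tendsto (fun r : ℝ => m * (Real.exp (l * (r ^ 2 - ‖x‖ ^ 2)) - 1)) (𝓝[<] 1)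
          (𝓝 (m * (Real.exp (l * (1 ^ 2 - ‖x‖ ^ 2)) - 1))) :=
        (Continuous.tendsto (by fun_prop) 1).mono_left nhdsWithin_le_nhds
      refine le_of_tendsto hc ?_
      filter_upwards [Ioo_mem_nhdsLT hx] with r hr
      exact exp_barrier_le hK hu hu0 hsup hl hm ((norm_nonneg x).trans hr.1.le) hr.2 hmin h hr.1.le
    refine le_trans ?_ hlim
    rw [mul_assoc]
    gcongr
    have h1 := Real.add_one_le_exp (l * (1 ^ 2 - ‖x‖ ^ 2))
    have h2 : 1 - ‖x‖ ≤ 1 ^ 2 - ‖x‖ ^ 2 := by nlinarith [norm_nonneg x]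
    have h3 : l * (1 - ‖x‖) ≤ l * (1 ^ 2 - ‖x‖ ^ 2) :=
      mul_le_mul_of_nonneg_left h2 (by linarith)
    linarith

lemma setIntegral_mul_dist_pow_le {K : ℝ} (hK : 0 ≤ K) {u : E → ℝ}
    (hu : ContDiffOn ℝ 2 u (ball 0 1)) (hu0 : ∀ x ∈ ball (0 : E) 1, 0 ≤ u x)
    (hsup : ∀ x ∈ ball (0 : E) 1, lap u x ≤ K * u x) {k : ℕ} (hk : 2 * N + K + 1 ≤ (k : ℝ) + 2)
    {t : ℝ} (ht0 : 0 ≤ t) (ht1 : t < 1) :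
    ∫ x in ball (0 : E) t, u x * (1 - ‖x‖) ^ (k + 1)
      ≤ 2 ^ (k + 1) * (K + 2 * ((k : ℝ) + 3) * N + 1) * ∫ x in ball (0 : E) (1 / 2), u x := by
  set r := √((1 + t ^ 2) / 2) with hr
  have hr0 : 0 ≤ r := Real.sqrt_nonneg _
  have hr2 : r ^ 2 = (1 + t ^ 2) / 2 := Real.sq_sqrt (by positivity)
  have hr1 : r < 1 := by
    rw [hr, Real.sqrt_lt' one_pos]
    nlinarith
  have hI := integrable_mul_bump isOpen_ball hr0 (closedBall_subset_ball hr1) hu.continuousOn k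
  have hI' : IntegrableOn (fun x => u x * (1 - ‖x‖) ^ (k + 1)) (ball (0 : E) t) := by
    refine (ContinuousOn.integrableOn_compact (isCompact_closedBall (0 : E) t) ?_).mono_set
      ball_subset_closedBall
    exact (hu.continuousOn.mono (closedBall_subset_ball ht1)).mul (by fun_prop)
  have h1 : ∫ x in ball (0 : E) t, u x * (1 - ‖x‖) ^ (k + 1)
      ≤ ∫ x, 2 ^ (k + 1) * (u x * bump r (k + 1) x) := by
    refine le_trans (setIntegral_mono_on hI' (hI.const_mul _).integrableOn measurableSet_ball
      fun x hx => ?_) (setIntegral_le_integral (hI.const_mul _) (Eventually.of_forall fun x => ?_))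
    · have hx1 : ‖x‖ < t := by simpa using hx
      rw [mul_left_comm]
      refine mul_le_mul_of_nonneg_left ?_ (hu0 x (ball_subset_ball ht1.le hx))
      rw [bump, ← mul_pow]
      refine pow_le_pow_left₀ (by linarith) ?_ _
      have h2 := le_max_left (r ^ 2 - ‖x‖ ^ 2) 0
      nlinarith [norm_nonneg x]
    · by_cases hx : x ∈ ball (0 : E) 1
      · exact mul_nonneg (by positivity) (mul_nonneg (hu0 x hx) (bump_nonneg _ _ _))
      · have : r ≤ ‖x‖ := hr1.le.trans (by simpa using hx)
        simp [bump_eq_zero hr0 k this]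
  rw [integral_const_mul] at h1
  refine h1.trans ?_
  rw [mul_assoc]
  gcongr
  exact integral_mul_bump_le hK hu hu0 hsup hk hr0 hr1

lemma integrableOn_dist_rpow (hN : 1 ≤ N) :
    IntegrableOn (fun x : E => (1 - ‖x‖) ^ (-(1 / 2) : ℝ)) (ball 0 1) := by
  have : Nonempty (Fin N) := ⟨⟨0, hN⟩⟩
  rw [integrableOn_fun_norm_addHaar volume (f := fun s => (1 - s) ^ (-(1 / 2) : ℝ))]
  have h1 : IntervalIntegrable (fun s : ℝ => (1 - s) ^ (-(1 / 2) : ℝ)) volume 0 1 := by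
    have := (intervalIntegral.intervalIntegrable_rpow' (a := 0) (b := 1)
      (r := (-(1 / 2) : ℝ)) (by norm_num)).comp_sub_left 1
    simpa using this.symm
  have h2 := h1.continuousOn_mul (g := fun s : ℝ => s ^ (Module.finrank ℝ E - 1)) (by fun_prop)
  rw [intervalIntegrable_iff_integrableOn_Ioo_of_le zero_le_one] at h2
  exact h2

lemma div_rpow_le_young {m : ℕ} {ε a d J : ℝ} (hε : ε = 1 / (2 * m + 3)) (ha : 0 ≤ a)
    (hd : 0 < d) (hJ : 0 < J) :
    (a / d) ^ ε ≤ J ^ ε * (J⁻¹ * (a * d ^ m) + d ^ (-(1 / 2) : ℝ)) := by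
  have hm : (0 : ℝ) < 2 * m + 3 := by positivity
  have hε0 : 0 < ε := by rw [hε]; positivity
  have hεm : ε * (2 * m + 3) = 1 := by rw [hε]; field_simp
  have hε1 : ε ≤ 1 := by nlinarith [(Nat.cast_nonneg m : (0 : ℝ) ≤ m)]
  have hT : 0 ≤ J⁻¹ * (a * d ^ m) := by positivity
  have hq : 0 ≤ d ^ (-(1 / 2) : ℝ) := by positivity
  have h1 : a / d = J * (J⁻¹ * (a * d ^ m)) * d ^ (-((m : ℝ) + 1)) := by
    rw [Real.rpow_neg hd.le, ← Nat.cast_succ, Real.rpow_natCast, pow_succ]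
    field_simp
  have h2 : (d ^ (-((m : ℝ) + 1))) ^ ε = (d ^ (-(1 / 2) : ℝ)) ^ (1 - ε) := by
    rw [← Real.rpow_mul hd.le, ← Real.rpow_mul hd.le]
    congr 1
    linarith
  rw [h1, Real.mul_rpow (by positivity) (by positivity), Real.mul_rpow hJ.le hT, h2, mul_assoc]
  refine mul_le_mul_of_nonneg_left ?_ (by positivity)
  have h3 := Real.geom_mean_le_arith_mean2_weighted hε0.le (sub_nonneg.2 hε1) hT hq (by ring)
  nlinarith

lemma setIntegral_div_dist_rpow_le (hN : 1 ≤ N) {K : ℝ} (hK : 0 ≤ K) {u : E → ℝ}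
    (hu : ContDiffOn ℝ 2 u (ball 0 1)) (hu0 : ∀ x ∈ ball (0 : E) 1, 0 ≤ u x)
    (hsup : ∀ x ∈ ball (0 : E) 1, lap u x ≤ K * u x) {k : ℕ} (hk : 2 * N + K + 1 ≤ (k : ℝ) + 2)
    {ε J : ℝ} (hε : ε = 1 / (2 * (k + 1 : ℕ) + 3)) (hJ0 : 0 < J)
    (hJ : ∫ x in ball (0 : E) (1 / 2), u x ≤ J) {S : Set E} (hS : MeasurableSet S)
    (hSb : S ⊆ ball 0 1) :
    ∫ x in S, (u x / (1 - ‖x‖)) ^ ε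
      ≤ J ^ ε * (2 ^ (k + 1) * (K + 2 * ((k : ℝ) + 3) * N + 1)
        + ∫ x in ball (0 : E) 1, (1 - ‖x‖) ^ (-(1 / 2) : ℝ)) := by
  set B : ℝ := 2 ^ (k + 1) * (K + 2 * ((k : ℝ) + 3) * N + 1)
  have hB : 0 ≤ B := by positivity
  have hd : ∀ x ∈ ball (0 : E) 1, 0 < 1 - ‖x‖ := fun x hx => by
    have : ‖x‖ < 1 := by simpa using hx
    linarith
  have hD0 : 0 ≤ ∫ x in ball (0 : E) 1, (1 - ‖x‖) ^ (-(1 / 2) : ℝ) :=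
    setIntegral_nonneg measurableSet_ball fun x hx => Real.rpow_nonneg (hd x hx).le _
  by_cases hint : IntegrableOn (fun x => (u x / (1 - ‖x‖)) ^ ε) S
  swap
  · rw [integral_undef hint]
    positivity
  have hbound : ∀ t : ℝ, 0 ≤ t → t < 1 → ∫ x in S ∩ ball (0 : E) t, (u x / (1 - ‖x‖)) ^ ε
      ≤ J ^ ε * (B + ∫ x in ball (0 : E) 1, (1 - ‖x‖) ^ (-(1 / 2) : ℝ)) := by
    intro t ht0 ht1
    have hI' : IntegrableOn (fun x => u x * (1 - ‖x‖) ^ (k + 1)) (ball (0 : E) t) := by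
      refine (ContinuousOn.integrableOn_compact (isCompact_closedBall (0 : E) t) ?_).mono_set
        ball_subset_closedBall
      exact (hu.continuousOn.mono (closedBall_subset_ball ht1)).mul (by fun_prop)
    have hD := integrableOn_dist_rpow hN
    have i1 : IntegrableOn (fun x => J⁻¹ * (u x * (1 - ‖x‖) ^ (k + 1))) (S ∩ ball (0 : E) t) :=
      (hI'.mono_set inter_subset_right).const_mul _
    have i2 : IntegrableOn (fun x : E => (1 - ‖x‖) ^ (-(1 / 2) : ℝ)) (S ∩ ball (0 : E) t) :=
      hD.mono_set (inter_subset_left.trans hSb)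
    calc ∫ x in S ∩ ball (0 : E) t, (u x / (1 - ‖x‖)) ^ ε
        ≤ ∫ x in S ∩ ball (0 : E) t, J ^ ε *
            (J⁻¹ * (u x * (1 - ‖x‖) ^ (k + 1)) + (1 - ‖x‖) ^ (-(1 / 2) : ℝ)) :=
          setIntegral_mono_on (hint.mono_set inter_subset_left) ((i1.add i2).const_mul _)
            (hS.inter measurableSet_ball) fun x hx =>
              div_rpow_le_young hε (hu0 x (hSb hx.1)) (hd x (hSb hx.1)) hJ0
      _ = J ^ ε * (J⁻¹ * ∫ x in S ∩ ball (0 : E) t, u x * (1 - ‖x‖) ^ (k + 1)) + J ^ ε *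
            ∫ x in S ∩ ball (0 : E) t, (1 - ‖x‖) ^ (-(1 / 2) : ℝ) := by
          rw [integral_const_mul, integral_add i1 i2, integral_const_mul, mul_add]
      _ ≤ J ^ ε * (J⁻¹ * (B * J)) + J ^ ε *
            ∫ x in ball (0 : E) 1, (1 - ‖x‖) ^ (-(1 / 2) : ℝ) := by
          have h1 : ∫ x in S ∩ ball (0 : E) t, u x * (1 - ‖x‖) ^ (k + 1)
              ≤ ∫ x in ball (0 : E) t, u x * (1 - ‖x‖) ^ (k + 1) := by
            refine setIntegral_mono_set hI' ?_ inter_subset_right.eventuallyLE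
            filter_upwards [ae_restrict_mem measurableSet_ball] with x hx
            have hx1 := ball_subset_ball ht1.le hx
            exact mul_nonneg (hu0 x hx1) (pow_nonneg (hd x hx1).le _)
          have h2 := setIntegral_mul_dist_pow_le hK hu hu0 hsup hk ht0 ht1
          have h3 : B * (∫ x in ball (0 : E) (1 / 2), u x) ≤ B * J := by gcongr
          have h4 : ∫ x in S ∩ ball (0 : E) t, (1 - ‖x‖) ^ (-(1 / 2) : ℝ)
              ≤ ∫ x in ball (0 : E) 1, (1 - ‖x‖) ^ (-(1 / 2) : ℝ) := by
            refine setIntegral_mono_set hD ?_ (inter_subset_left.trans hSb).eventuallyLE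
            filter_upwards [ae_restrict_mem measurableSet_ball] with x hx
            exact Real.rpow_nonneg (hd x hx).le _
          gcongr
          exact h1.trans (h2.trans h3)
      _ = _ := by field_simp
  obtain ⟨t, htm, ht, hlim⟩ := exists_seq_strictMono_tendsto' (zero_lt_one (α := ℝ))
  have hU : ⋃ n, S ∩ ball (0 : E) (t n) = S := by
    rw [← inter_iUnion]
    refine inter_eq_left.2 fun x hx => ?_
    have hx1 : ‖x‖ < 1 := by simpa using hSb hx
    obtain ⟨n, hn⟩ := (hlim.eventually (lt_mem_nhds hx1)).exists
    exact mem_iUnion.2 ⟨n, by simpa using hn⟩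
  have htend := tendsto_setIntegral_of_monotone (μ := volume)
    (f := fun x => (u x / (1 - ‖x‖)) ^ ε)
    (fun n => hS.inter (measurableSet_ball (x := (0 : E)) (ε := t n)))
    (fun i j hij => inter_subset_inter_right S (ball_subset_ball (htm.monotone hij)))
    (by rwa [hU])
  rw [hU] at htend
  exact le_of_tendsto' htend fun n => hbound (t n) (ht n).1.le (ht n).2

lemma exists_mul_setIntegral_half_ball_le {K : ℝ} (hK : 0 ≤ K) :
    ∃ c : ℝ, 0 < c ∧ ∀ u : E → ℝ, ContDiffOn ℝ 2 u (ball 0 1) →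
      (∀ x ∈ ball 0 1, 0 ≤ u x) → (∀ x ∈ ball 0 1, lap u x ≤ K * u x) →
      ∀ x ∈ ball 0 1, c * ∫ y in ball 0 (1 / 2), u y ≤ u x / (1 - ‖x‖) := by
  obtain ⟨l, hl⟩ : ∃ l : ℝ, l = 16 * (2 * N + K + 1) := ⟨_, rfl⟩
  have hl0 : 0 < l := by rw [hl]; positivity
  have he : 0 < Real.exp l - 1 := by linarith [Real.add_one_le_exp l]
  set V := ∫ y, bump 1 1 (y : E)
  have hV : 0 ≤ V := integral_nonneg fun y => bump_nonneg _ _ _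
  set C := 36 / 11 * Real.exp K * V + 1
  have hC : 0 < C := by positivity
  refine ⟨l / (C * (Real.exp l - 1)), by positivity, fun u hu hu0 hsup x hx => ?_⟩
  have hx1 : ‖x‖ < 1 := by simpa using hx
  set I := ∫ y in ball (0 : E) (1 / 2), u y
  have hI : 0 ≤ I := setIntegral_nonneg measurableSet_ball fun y hy =>
    hu0 y (ball_subset_ball (by norm_num) hy)
  have h := le_of_le_on_closedBall hK hu hu0 hsup hl
    (m := I / (C * (Real.exp l - 1))) (by positivity) (fun z hz => ?_) hx1
  · rw [le_div_iff₀ (by linarith)]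
    refine le_trans (le_of_eq ?_) h
    ring
  · have h1 := setIntegral_half_ball_le hK hu hu0 hsup hz
    have h2 : 0 ≤ u z := hu0 z (by rw [mem_ball_zero_iff]; linarith)
    rw [div_mul_eq_mul_div, mul_div_mul_right _ _ he.ne', div_le_iff₀ hC, mul_comm (u z)]
    exact h1.trans (mul_le_mul_of_nonneg_right (le_add_of_nonneg_right zero_le_one) h2)

end Supersolution

/-- Boundary weak Harnack inequality (Theorem 3.1 for `p = 2`) on the unit ball:
for nonnegative supersolutions of `-Δu + a u ≥ 0`, `0 ≤ a ≤ K`, the quotient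
`u(x)/dist(x,∂ω)` satisfies a weak Harnack inequality near any boundary point. -/
theorem stmt_5 {N : ℕ} (hN : 2 ≤ N) (K : ℝ) (hK : 0 ≤ K) :
    ∃ Rbar ε C : ℝ, 0 < Rbar ∧ 0 < ε ∧ 0 < C ∧
      ∀ a u : EuclideanSpace ℝ (Fin N) → ℝ,
        ContinuousOn a (ball (0 : EuclideanSpace ℝ (Fin N)) 1) →
        (∀ x ∈ ball (0 : EuclideanSpace ℝ (Fin N)) 1, 0 ≤ a x ∧ a x ≤ K) →
        ContDiffOn ℝ 2 u (ball (0 : EuclideanSpace ℝ (Fin N)) 1) →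
        (∀ x ∈ ball (0 : EuclideanSpace ℝ (Fin N)) 1, 0 ≤ u x) →
        (∀ x ∈ ball (0 : EuclideanSpace ℝ (Fin N)) 1, 0 ≤ -lap u x + a x * u x) →
        ∀ x₀ ∈ sphere (0 : EuclideanSpace ℝ (Fin N)) 1, ∀ R ∈ Ioc (0 : ℝ) Rbar,
          ∀ x ∈ ball x₀ R ∩ ball (0 : EuclideanSpace ℝ (Fin N)) 1,
            C * (∫ y in ball x₀ R ∩ ball (0 : EuclideanSpace ℝ (Fin N)) 1,
                  (u y / (1 - ‖y‖)) ^ ε) ^ (1 / ε)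
              ≤ u x / (1 - ‖x‖) := by
  obtain ⟨c, hc, hcu⟩ := exists_mul_setIntegral_half_ball_le (N := N) hK
  obtain ⟨k, hk⟩ := exists_nat_ge (2 * N + K + 1)
  have hk' : 2 * N + K + 1 ≤ (k : ℝ) + 2 := by linarith
  set ε : ℝ := 1 / (2 * (k + 1 : ℕ) + 3) with hε
  have hε0 : 0 < ε := by positivity
  set B : ℝ := 2 ^ (k + 1) * (K + 2 * ((k : ℝ) + 3) * N + 1)
    + ∫ x in ball (0 : EuclideanSpace ℝ (Fin N)) 1, (1 - ‖x‖) ^ (-(1 / 2) : ℝ)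
  have hB0 : 0 < B := by
    refine add_pos_of_pos_of_nonneg (by positivity)
      (setIntegral_nonneg measurableSet_ball fun x hx => Real.rpow_nonneg ?_ _)
    rw [mem_ball_zero_iff] at hx
    linarith
  refine ⟨1, ε, c / B ^ (1 / ε), one_pos, hε0, by positivity, ?_⟩
  intro a u _ ha hu hu0 hsuper x₀ _ R _ x hx
  have hsup : ∀ x ∈ ball (0 : EuclideanSpace ℝ (Fin N)) 1, lap u x ≤ K * u x := fun x hx => by
    have := mul_le_mul_of_nonneg_right (ha x hx).2 (hu0 x hx)
    linarith [hsuper x hx]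
  refine le_trans ?_ (hcu u hu hu0 hsup x hx.2)
  have hI : 0 ≤ ∫ y in ball (0 : EuclideanSpace ℝ (Fin N)) (1 / 2), u y :=
    setIntegral_nonneg measurableSet_ball fun y hy => hu0 y (ball_subset_ball (by norm_num) hy)
  set P := ∫ y in ball x₀ R ∩ ball (0 : EuclideanSpace ℝ (Fin N)) 1, (u y / (1 - ‖y‖)) ^ ε
  have hP : 0 ≤ P := by
    refine setIntegral_nonneg (measurableSet_ball.inter measurableSet_ball) fun y hy => ?_
    have hy1 : ‖y‖ < 1 := by simpa using hy.2
    exact Real.rpow_nonneg (div_nonneg (hu0 y hy.2) (by linarith)) _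
  have hJ : ∀ J, ∫ y in ball (0 : EuclideanSpace ℝ (Fin N)) (1 / 2), u y < J →
      P ^ (1 / ε) / B ^ (1 / ε) ≤ J := by
    intro J hJ
    have hJ0 : 0 < J := hI.trans_lt hJ
    have h1 : P ≤ J ^ ε * B := setIntegral_div_dist_rpow_le (by omega) hK hu hu0 hsup hk' hε hJ0
      hJ.le (measurableSet_ball.inter measurableSet_ball) inter_subset_right
    rw [div_le_iff₀ (by positivity)]
    calc P ^ (1 / ε) ≤ (J ^ ε * B) ^ (1 / ε) := by gcongr
      _ = J * B ^ (1 / ε) := by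
        rw [Real.mul_rpow (by positivity) hB0.le, ← Real.rpow_mul hJ0.le,
          mul_one_div_cancel hε0.ne', Real.rpow_one]
  rw [div_mul_eq_mul_div, mul_div_assoc]
  exact mul_le_mul_of_nonneg_left (le_of_forall_gt_imp_ge_of_dense hJ) hc.le
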